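/- Assume a, b, d ∈ C¹([0,R]) and c ∈ C¹(Ω̄), and let w : ℝ³ → ℝ be twice continuously differentiable on a neighbourhood of Ω̄. For x ∈ Ω \ {0} let (A w)(x) = Σ_{j,k=1}^{3} ∂_{x_j}(a_{j,k}(·) ∂_{x_k} w)(x) denote the divergence-form operator with coefficients a_{j,k}. Then for every r ∈ (0,R) the spherical mean Φ[w] is twice differentiable at r and Φ[A w](r) = h(r)(Φ[w])''(r) + h'(r)(Φ[w])'(r) + (2h(r)/r)(Φ[w])'(r); that is, Φ ∘ A = Ã₁ ∘ Φ, where Ã₁ = D_r(h(r) D_r) + (2h(r)/r) D_r. -/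

import Mathlib

open Real MeasureTheory

/-- The point of the unit sphere with spherical coordinates `(φ, θ)`. -/
noncomputable def sph (φ θ : ℝ) : EuclideanSpace ℝ (Fin 3) :=
  (EuclideanSpace.equiv (Fin 3) ℝ).symm
    ![Real.cos φ * Real.sin θ, Real.sin φ * Real.sin θ, Real.cos θ]

/-- The spherical mean operator
`Φ[v](r) = ∫₀^π sin θ (∫₀^{2π} v(r x'(φ,θ)) dφ) dθ`. -/
noncomputable def Phi (v : EuclideanSpace ℝ (Fin 3) → ℝ) (r : ℝ) : ℝ :=
  ∫ θ in (0:ℝ)..Real.pi, Real.sin θ * ∫ φ in (0:ℝ)..(2 * Real.pi), v (r • sph φ θ)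

/-- The matrix coefficients `a_{j,k}(x)` from the paper, for `x ≠ 0`.
For the diagonal entries we use that e.g. `x₂² + x₃² = |x|² - x₁²`. -/
noncomputable def aCoef (a b d : ℝ → ℝ) (c : EuclideanSpace ℝ (Fin 3) → ℝ)
    (x : EuclideanSpace ℝ (Fin 3)) (j k : Fin 3) : ℝ :=
  if j = k then
    a ‖x‖ + (‖x‖ ^ 2 - x j ^ 2) * (c x + b ‖x‖) / ‖x‖ ^ 2 - x j ^ 2 * d ‖x‖ / ‖x‖ ^ 2
  else
    -(x j * x k * (b ‖x‖ + c x + d ‖x‖)) / ‖x‖ ^ 2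

/-- The partial derivative `∂_{x_i} f`. -/
noncomputable def pd (i : Fin 3) (f : EuclideanSpace ℝ (Fin 3) → ℝ) :
    EuclideanSpace ℝ (Fin 3) → ℝ :=
  fun x => fderiv ℝ f x (EuclideanSpace.single i 1)

/-- The divergence-form operator `A w = Σ_{j,k} ∂_{x_j}(a_{j,k} ∂_{x_k} w)`. -/
noncomputable def Aop (a b d : ℝ → ℝ) (c : EuclideanSpace ℝ (Fin 3) → ℝ)
    (w : EuclideanSpace ℝ (Fin 3) → ℝ) : EuclideanSpace ℝ (Fin 3) → ℝ :=
  fun x => ∑ j, ∑ k, pd j (fun y => aCoef a b d c y j k * pd k w y) x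

local notation "E3" => EuclideanSpace ℝ (Fin 3)

/-- The polar tangent vector `∂_θ` of the unit sphere. -/
noncomputable def sphPolar (φ θ : ℝ) : E3 :=
  (EuclideanSpace.equiv (Fin 3) ℝ).symm
    ![Real.cos φ * Real.cos θ, Real.sin φ * Real.cos θ, -Real.sin θ]

/-- The unit azimuthal tangent vector `(∂_φ) / sin θ` of the unit sphere. -/
noncomputable def sphAzimuth (φ : ℝ) : E3 :=
  (EuclideanSpace.equiv (Fin 3) ℝ).symm ![-Real.sin φ, Real.cos φ, 0]

lemma hasDerivAt_euclidean {f : ℝ → Fin 3 → ℝ} {f' : Fin 3 → ℝ} {t : ℝ}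
    (h : ∀ i, HasDerivAt (fun s => f s i) (f' i) t) :
    HasDerivAt (fun s => (EuclideanSpace.equiv (Fin 3) ℝ).symm (f s))
      ((EuclideanSpace.equiv (Fin 3) ℝ).symm f') t :=
  ((EuclideanSpace.equiv (Fin 3) ℝ).symm.toContinuousLinearMap.hasFDerivAt).comp_hasDerivAt t
    (hasDerivAt_pi.2 h)

lemma hasDerivAt_sph_polar (φ θ : ℝ) :
    HasDerivAt (fun t => sph φ t) (sphPolar φ θ) θ := by
  refine hasDerivAt_euclidean fun i => ?_
  fin_cases i
  · exact (Real.hasDerivAt_sin θ).const_mul _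
  · exact (Real.hasDerivAt_sin θ).const_mul _
  · exact Real.hasDerivAt_cos θ

lemma hasDerivAt_sph_azimuth (φ θ : ℝ) :
    HasDerivAt (fun t => sph t θ) (Real.sin θ • sphAzimuth φ) φ := by
  rw [sphAzimuth, ← map_smul]
  refine hasDerivAt_euclidean fun i => ?_
  fin_cases i
  · simpa [mul_comm] using (Real.hasDerivAt_cos φ).mul_const (Real.sin θ)
  · simpa [mul_comm] using (Real.hasDerivAt_sin φ).mul_const (Real.sin θ)
  · simpa using hasDerivAt_const φ (Real.cos θ)

lemma hasDerivAt_sphPolar (φ θ : ℝ) :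
    HasDerivAt (fun t => sphPolar φ t) (-sph φ θ) θ := by
  rw [sph, ← map_neg]
  refine hasDerivAt_euclidean fun i => ?_
  fin_cases i
  · simpa using (Real.hasDerivAt_cos θ).const_mul (Real.cos φ)
  · simpa using (Real.hasDerivAt_cos θ).const_mul (Real.sin φ)
  · exact (Real.hasDerivAt_sin θ).fun_neg

lemma hasDerivAt_sphAzimuth (φ θ : ℝ) :
    HasDerivAt sphAzimuth (-(Real.sin θ • sph φ θ + Real.cos θ • sphPolar φ θ)) φ := by
  rw [sph, sphPolar, ← map_smul, ← map_smul, ← map_add, ← map_neg]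
  refine hasDerivAt_euclidean fun i => ?_
  have h := Real.sin_sq_add_cos_sq θ
  fin_cases i
  · refine (Real.hasDerivAt_sin φ).neg.congr_deriv ?_
    simp
    linear_combination Real.cos φ * h
  · refine (Real.hasDerivAt_cos φ).congr_deriv ?_
    simp
    linear_combination Real.sin φ * h
  · refine (hasDerivAt_const φ (0 : ℝ)).congr_deriv ?_
    simp
    ring

lemma continuous_sph : Continuous fun p : ℝ × ℝ => sph p.1 p.2 := by
  refine (EuclideanSpace.equiv (Fin 3) ℝ).symm.continuous.comp (continuous_pi fun i => ?_)
  fin_cases i <;> simp <;> fun_prop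

lemma continuous_sphPolar : Continuous fun p : ℝ × ℝ => sphPolar p.1 p.2 := by
  refine (EuclideanSpace.equiv (Fin 3) ℝ).symm.continuous.comp (continuous_pi fun i => ?_)
  fin_cases i <;> simp <;> fun_prop

lemma continuous_sphAzimuth : Continuous sphAzimuth :=
  continuous_iff_continuousAt.2 fun φ => (hasDerivAt_sphAzimuth φ 0).continuousAt

lemma norm_sph (φ θ : ℝ) : ‖sph φ θ‖ = 1 := by
  rw [EuclideanSpace.norm_eq, Real.sqrt_eq_one, Fin.sum_univ_three]
  simp only [sph, Real.norm_eq_abs, sq_abs, PiLp.coe_symm_continuousLinearEquiv, Matrix.cons_val]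
  linear_combination (Real.sin θ) ^ 2 * Real.sin_sq_add_cos_sq φ + Real.sin_sq_add_cos_sq θ

lemma norm_smul_sph {r : ℝ} (hr : 0 ≤ r) (φ θ : ℝ) : ‖r • sph φ θ‖ = r := by
  rw [norm_smul, norm_sph, Real.norm_of_nonneg hr, mul_one]

lemma apply_eq_sum (L : E3 →L[ℝ] ℝ) (v : E3) :
    L v = ∑ i, v i * L (EuclideanSpace.single i 1) := by
  have hv : v = ∑ i, v i • EuclideanSpace.single i (1 : ℝ) := by
    ext j
    simp [Finset.sum_apply, Pi.single_apply]
  conv_lhs => rw [hv]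
  simp [map_sum]

/-- The trace of a bilinear form in the orthonormal frame of spherical coordinates. -/
lemma sum_diag_eq_frame (L : Fin 3 → E3 →L[ℝ] ℝ) (φ θ : ℝ) :
    ∑ j, L j (EuclideanSpace.single j 1)
      = ∑ j, L j (sphPolar φ θ) * sphPolar φ θ j + ∑ j, L j (sphAzimuth φ) * sphAzimuth φ j
        + ∑ j, L j (sph φ θ) * sph φ θ j := by
  have h1 := Real.sin_sq_add_cos_sq θ
  have h2 := Real.sin_sq_add_cos_sq φ
  simp only [apply_eq_sum _ (sphPolar φ θ), apply_eq_sum _ (sphAzimuth φ),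
    apply_eq_sum _ (sph φ θ), Fin.sum_univ_three]
  generalize EuclideanSpace.single (0 : Fin 3) (1 : ℝ) = e0
  generalize EuclideanSpace.single (1 : Fin 3) (1 : ℝ) = e1
  generalize EuclideanSpace.single (2 : Fin 3) (1 : ℝ) = e2
  simp only [sph, sphPolar, sphAzimuth, PiLp.coe_symm_continuousLinearEquiv, Matrix.cons_val]
  linear_combination
    (-(L 0 e0 * Real.cos φ ^ 2 + L 1 e1 * Real.sin φ ^ 2 + L 2 e2
      + (L 0 e1 + L 1 e0) * Real.cos φ * Real.sin φ)) * h1 - (L 0 e0 + L 1 e1) * h2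

lemma integral_integral_swap_of_continuous {f : ℝ → ℝ → ℝ} (hf : Continuous f.uncurry)
    (a b c d : ℝ) :
    ∫ x in a..b, ∫ y in c..d, f x y = ∫ y in c..d, ∫ x in a..b, f x y := by
  apply intervalIntegral_intervalIntegral_swap
  exact ((hf.continuousOn.integrableOn_compact
    (isCompact_uIcc.prod isCompact_uIcc)).mono_set
      (Set.prod_mono Set.uIoc_subset_uIcc Set.uIoc_subset_uIcc))

lemma hasDerivAt_integral_of_continuous {f f' : ℝ → ℝ → ℝ} (hf : Continuous f.uncurry)
    (hf' : Continuous f'.uncurry) (h : ∀ x y, HasDerivAt (fun t => f t y) (f' x y) x)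
    (a b x : ℝ) :
    HasDerivAt (fun t => ∫ y in a..b, f t y) (∫ y in a..b, f' x y) x := by
  obtain ⟨C, hC⟩ := (isCompact_Icc (a := x - 1) (b := x + 1)).prod
    (isCompact_uIcc (a := a) (b := b)) |>.exists_bound_of_continuousOn hf'.continuousOn
  have hfx : ∀ t, Continuous (f t) := fun t => hf.comp (Continuous.prodMk_right t)
  have hfx' : ∀ t, Continuous (f' t) := fun t => hf'.comp (Continuous.prodMk_right t)
  refine (intervalIntegral.hasDerivAt_integral_of_dominated_loc_of_deriv_le
    (bound := fun _ => C) (F' := f') (s := Set.Icc (x - 1) (x + 1))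
    (Icc_mem_nhds (by linarith) (by linarith))
    (Filter.Eventually.of_forall fun t => (hfx t).aestronglyMeasurable)
    ((hfx x).intervalIntegrable _ _) (hfx' x).aestronglyMeasurable ?_
    intervalIntegrable_const ?_).2
  · exact Filter.Eventually.of_forall fun t ht s hs => hC (s, t) ⟨hs, Set.uIoc_subset_uIcc ht⟩
  · exact Filter.Eventually.of_forall fun t _ s _ => h s t

lemma hasDerivAt_sphere_integral {f f' : ℝ → ℝ → ℝ → ℝ}
    (hf : Continuous fun p : ℝ × ℝ × ℝ => f p.1 p.2.1 p.2.2)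
    (hf' : Continuous fun p : ℝ × ℝ × ℝ => f' p.1 p.2.1 p.2.2)
    (h : ∀ r θ φ, HasDerivAt (fun t => f t θ φ) (f' r θ φ) r) (a b c d r : ℝ) :
    HasDerivAt (fun t => ∫ θ in a..b, Real.sin θ * ∫ φ in c..d, f t θ φ)
      (∫ θ in a..b, Real.sin θ * ∫ φ in c..d, f' r θ φ) r := by
  have key : ∀ g : ℝ → ℝ → ℝ → ℝ, (Continuous fun p : ℝ × ℝ × ℝ => g p.1 p.2.1 p.2.2) →
      Continuous (Function.uncurry fun t θ => Real.sin θ * ∫ φ in c..d, g t θ φ) := by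
    intro g hg
    refine (Real.continuous_sin.comp continuous_snd).mul ?_
    exact intervalIntegral.continuous_parametric_intervalIntegral_of_continuous'
      (f := fun (p : ℝ × ℝ) φ => g p.1 p.2 φ)
      (hg.comp (by fun_prop : Continuous fun q : (ℝ × ℝ) × ℝ => (q.1.1, q.1.2, q.2))) c d
  refine hasDerivAt_integral_of_continuous (key f hf) (key f' hf') (fun t θ => ?_) a b r
  refine (hasDerivAt_integral_of_continuous (f := fun t φ => f t θ φ)
    (f' := fun t φ => f' t θ φ) ?_ ?_ (fun t φ => h t θ φ) c d t).const_mul _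
  · exact hf.comp (by fun_prop : Continuous fun q : ℝ × ℝ => (q.1, θ, q.2))
  · exact hf'.comp (by fun_prop : Continuous fun q : ℝ × ℝ => (q.1, θ, q.2))

lemma sphere_integral_divergence {F : Fin 3 → E3 → ℝ} {r : ℝ}
    (hF : ∀ j φ θ, ContDiffAt ℝ 1 (F j) (r • sph φ θ)) :
    r * ∫ θ in (0:ℝ)..π, Real.sin θ * ∫ φ in (0:ℝ)..(2 * π),
        ∑ j, fderiv ℝ (F j) (r • sph φ θ) (EuclideanSpace.single j 1)
      = ∫ θ in (0:ℝ)..π, Real.sin θ * ∫ φ in (0:ℝ)..(2 * π),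
        (r * ∑ j, fderiv ℝ (F j) (r • sph φ θ) (sph φ θ) * sph φ θ j
          + 2 * ∑ j, F j (r • sph φ θ) * sph φ θ j) := by
  have hs : Continuous fun p : ℝ × ℝ => r • sph p.1 p.2 := continuous_sph.const_smul r
  have hFc : ∀ j, Continuous fun p : ℝ × ℝ => F j (r • sph p.1 p.2) := fun j =>
    continuous_iff_continuousAt.2 fun p =>
      ContinuousAt.comp (f := fun p : ℝ × ℝ => r • sph p.1 p.2) (x := p)
        (hF j p.1 p.2).continuousAt hs.continuousAt
  have hDc : ∀ j, Continuous fun p : ℝ × ℝ => fderiv ℝ (F j) (r • sph p.1 p.2) := fun j =>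
    continuous_iff_continuousAt.2 fun p =>
      ContinuousAt.comp (f := fun p : ℝ × ℝ => r • sph p.1 p.2) (x := p)
        ((hF j p.1 p.2).fderiv_right (m := 0) (by norm_num)).continuousAt hs.continuousAt
  have hFd : ∀ j φ θ, HasFDerivAt (F j) (fderiv ℝ (F j) (r • sph φ θ)) (r • sph φ θ) :=
    fun j φ θ => ((hF j φ θ).differentiableAt (by norm_num)).hasFDerivAt
  have hcoord : ∀ (f : ℝ × ℝ → E3), Continuous f → ∀ j, Continuous fun p => f p j :=
    fun f hf j => (EuclideanSpace.proj (𝕜 := ℝ) j).continuous.comp hf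
  have hder : ∀ (f : ℝ → E3) (f' : E3) (t : ℝ), HasDerivAt f f' t →
      ∀ j, HasDerivAt (fun t => f t j) (f' j) t := fun f f' t hf j =>
    ((EuclideanSpace.proj (𝕜 := ℝ) j).hasFDerivAt).comp_hasDerivAt t hf
  set P' : ℝ → ℝ → ℝ := fun φ θ =>
    Real.cos θ * ∑ j, F j (r • sph φ θ) * sphPolar φ θ j
      + Real.sin θ * ∑ j, (fderiv ℝ (F j) (r • sph φ θ) (r • sphPolar φ θ) * sphPolar φ θ j
          + F j (r • sph φ θ) * (-sph φ θ) j) with hP'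
  set Q' : ℝ → ℝ → ℝ := fun φ θ =>
    ∑ j, (fderiv ℝ (F j) (r • sph φ θ) (r • (Real.sin θ • sphAzimuth φ)) * sphAzimuth φ j
      + F j (r • sph φ θ) * (-(Real.sin θ • sph φ θ + Real.cos θ • sphPolar φ θ)) j) with hQ'
  have hP : ∀ φ θ, HasDerivAt
      (fun t => Real.sin t * ∑ j, F j (r • sph φ t) * sphPolar φ t j) (P' φ θ) θ := by
    intro φ θ
    refine (Real.hasDerivAt_sin θ).mul (HasDerivAt.fun_sum fun j _ => HasDerivAt.mul ?_ ?_)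
    · exact (hFd j φ θ).comp_hasDerivAt θ ((hasDerivAt_sph_polar φ θ).const_smul r)
    · exact hder _ _ _ (hasDerivAt_sphPolar φ θ) j
  have hQ : ∀ φ θ, HasDerivAt
      (fun t => ∑ j, F j (r • sph t θ) * sphAzimuth t j) (Q' φ θ) φ := by
    intro φ θ
    refine HasDerivAt.fun_sum fun j _ => HasDerivAt.mul ?_ ?_
    · exact (hFd j φ θ).comp_hasDerivAt φ ((hasDerivAt_sph_azimuth φ θ).const_smul r)
    · exact hder _ _ _ (hasDerivAt_sphAzimuth φ θ) j
  have cs := continuous_sph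
  have cT := continuous_sphPolar
  have cA : Continuous fun p : ℝ × ℝ => sphAzimuth p.1 := continuous_sphAzimuth.comp continuous_fst
  have csin : Continuous fun p : ℝ × ℝ => Real.sin p.2 := by fun_prop
  have ccos : Continuous fun p : ℝ × ℝ => Real.cos p.2 := by fun_prop
  have cP' : Continuous P'.uncurry :=
    (ccos.mul (continuous_finsetSum _ fun j _ => (hFc j).mul (hcoord _ cT j))).add
      (csin.mul (continuous_finsetSum _ fun j _ =>
        (((hDc j).clm_apply (cT.const_smul r)).mul (hcoord _ cT j)).add
          ((hFc j).mul (hcoord _ cs.neg j))))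
  have cQ' : Continuous Q'.uncurry :=
    continuous_finsetSum _ fun j _ =>
        (((hDc j).clm_apply ((csin.smul cA).const_smul r)).mul (hcoord _ cA j)).add
          ((hFc j).mul (hcoord _ ((csin.smul cs).add (ccos.smul cT)).neg j))
  have cR : Continuous (Function.uncurry fun φ θ =>
      r * ∑ j, fderiv ℝ (F j) (r • sph φ θ) (sph φ θ) * sph φ θ j
        + 2 * ∑ j, F j (r • sph φ θ) * sph φ θ j) :=
    (continuous_const.mul (continuous_finsetSum _ fun j _ =>
      ((hDc j).clm_apply cs).mul (hcoord _ cs j))).add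
      (continuous_const.mul (continuous_finsetSum _ fun j _ => (hFc j).mul (hcoord _ cs j)))
  have hpoint : ∀ φ θ, Real.sin θ * (r * ∑ j, fderiv ℝ (F j) (r • sph φ θ)
        (EuclideanSpace.single j 1))
      = P' φ θ + Q' φ θ + Real.sin θ *
        (r * ∑ j, fderiv ℝ (F j) (r • sph φ θ) (sph φ θ) * sph φ θ j
          + 2 * ∑ j, F j (r • sph φ θ) * sph φ θ j) := by
    intro φ θ
    rw [sum_diag_eq_frame (fun j => fderiv ℝ (F j) (r • sph φ θ)) φ θ]
    simp only [hP', hQ', map_smul, smul_eq_mul, PiLp.neg_apply, PiLp.add_apply, PiLp.smul_apply,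
      Fin.sum_univ_three]
    ring
  have hQint : ∀ θ, ∫ φ in (0:ℝ)..(2 * π), Q' φ θ = 0 := by
    intro θ
    rw [intervalIntegral.integral_eq_sub_of_hasDerivAt (fun φ _ => hQ φ θ)
      ((cQ'.comp (Continuous.prodMk_left θ)).intervalIntegrable _ _)]
    simp [sph, sphAzimuth]
  have hPint : ∀ φ, ∫ θ in (0:ℝ)..π, P' φ θ = 0 := by
    intro φ
    rw [intervalIntegral.integral_eq_sub_of_hasDerivAt (fun θ _ => hP φ θ)
      ((cP'.comp (Continuous.prodMk_right φ)).intervalIntegrable _ _)]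
    simp
  have hPP : ∫ θ in (0:ℝ)..π, ∫ φ in (0:ℝ)..(2 * π), P' φ θ = 0 := by
    rw [← integral_integral_swap_of_continuous cP']
    simp [hPint]
  have cinner : ∀ g : ℝ → ℝ → ℝ, Continuous g.uncurry →
      Continuous fun θ => ∫ φ in (0:ℝ)..(2 * π), g φ θ := fun g hg =>
    intervalIntegral.continuous_parametric_intervalIntegral_of_continuous'
      (f := fun θ φ => g φ θ) (hg.comp continuous_swap) _ _
  have hadd := intervalIntegral.integral_add ((cinner _ cP').intervalIntegrable (μ := volume) 0 π)
    ((Real.continuous_sin.mul (cinner _ cR)).intervalIntegrable 0 π)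
  rw [hPP, zero_add] at hadd
  rw [← intervalIntegral.integral_const_mul]
  refine Eq.trans ?_ hadd
  refine intervalIntegral.integral_congr fun θ _ => ?_
  have hsec : ∀ g : ℝ → ℝ → ℝ, Continuous g.uncurry →
      IntervalIntegrable (fun φ => g φ θ) volume 0 (2 * π) := fun g hg =>
    (hg.comp (Continuous.prodMk_left θ)).intervalIntegrable _ _
  calc r * (Real.sin θ * ∫ φ in (0:ℝ)..(2 * π),
        ∑ j, fderiv ℝ (F j) (r • sph φ θ) (EuclideanSpace.single j 1))
      = ∫ φ in (0:ℝ)..(2 * π), Real.sin θ * (r * ∑ j, fderiv ℝ (F j) (r • sph φ θ)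
        (EuclideanSpace.single j 1)) := by
        rw [intervalIntegral.integral_const_mul, intervalIntegral.integral_const_mul]
        ring
    _ = _ := by
        simp only [hpoint]
        rw [intervalIntegral.integral_add ((hsec _ cP').add (hsec _ cQ'))
            ((hsec _ cR).const_mul _),
          intervalIntegral.integral_add (hsec _ cP') (hsec _ cQ'), hQint, add_zero,
          intervalIntegral.integral_const_mul]
        rfl

lemma contDiffAt_aCoef {a b d : ℝ → ℝ} {c : E3 → ℝ} {x : E3} (hx : x ≠ 0)
    (ha : ContDiffAt ℝ 1 a ‖x‖) (hb : ContDiffAt ℝ 1 b ‖x‖) (hd : ContDiffAt ℝ 1 d ‖x‖)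
    (hc : ContDiffAt ℝ 1 c x) (j k : Fin 3) :
    ContDiffAt ℝ 1 (fun y => aCoef a b d c y j k) x := by
  have hn : ContDiffAt ℝ 1 (fun y : E3 => ‖y‖) x := contDiffAt_norm ℝ hx
  have ha' := ha.comp x hn
  have hb' := hb.comp x hn
  have hd' := hd.comp x hn
  have hn2 : ContDiffAt ℝ 1 (fun y : E3 => ‖y‖ ^ 2) x := hn.pow 2
  have h0 : ‖x‖ ^ 2 ≠ 0 := by simpa using hx
  have hcoord : ∀ i, ContDiffAt ℝ 1 (fun y : E3 => y i) x := fun i =>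
    (EuclideanSpace.proj (𝕜 := ℝ) i).contDiff.contDiffAt
  unfold aCoef
  split_ifs
  · exact (ha'.add (((hn2.sub ((hcoord j).pow 2)).mul (hc.add hb')).div hn2 h0)).sub
      ((((hcoord j).pow 2).mul hd').div hn2 h0)
  · exact ((((hcoord j).mul (hcoord k)).mul ((hb'.add hc).add hd')).neg).div hn2 h0

lemma contDiff_pd {w : E3 → ℝ} (hw : ContDiff ℝ 2 w) (k : Fin 3) : ContDiff ℝ 1 (pd k w) :=
  (hw.fderiv_right (m := 1) (by norm_num)).clm_apply contDiff_const

/-- Radial directions are eigenvectors of the coefficient matrix, with eigenvalue `a - d`. -/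
lemma sum_aCoef_mul_pd_radial (a b d : ℝ → ℝ) (c w : E3 → ℝ) {t : ℝ} (ht : 0 < t) (φ θ : ℝ) :
    ∑ j, (∑ k, aCoef a b d c (t • sph φ θ) j k * pd k w (t • sph φ θ)) * sph φ θ j
      = (a t - d t) * fderiv ℝ w (t • sph φ θ) (sph φ θ) := by
  have h1 : ∑ i, sph φ θ i ^ 2 = 1 := by
    rw [← EuclideanSpace.real_norm_sq_eq, norm_sph, one_pow]
  rw [apply_eq_sum]
  simp only [aCoef, norm_smul_sph ht.le, PiLp.smul_apply, smul_eq_mul, pd]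
  generalize sph φ θ = s at *
  simp only [Fin.sum_univ_three] at h1 ⊢
  simp only [Fin.isValue, reduceIte, zero_ne_one, one_ne_zero, Fin.reduceEq]
  generalize fderiv ℝ w (t • s) (EuclideanSpace.single (0 : Fin 3) (1 : ℝ)) = e0
  generalize fderiv ℝ w (t • s) (EuclideanSpace.single (1 : Fin 3) (1 : ℝ)) = e1
  generalize fderiv ℝ w (t • s) (EuclideanSpace.single (2 : Fin 3) (1 : ℝ)) = e2
  field_simp
  linear_combination (-(e0 * s 0 + e1 * s 1 + e2 * s 2)) * (b t + c (t • s) + d t) * h1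

lemma Aop_eq_sum_fderiv {a b d : ℝ → ℝ} {c w : E3 → ℝ} {x : E3}
    (h : ∀ j k, DifferentiableAt ℝ (fun y => aCoef a b d c y j k * pd k w y) x) :
    Aop a b d c w x = ∑ j, fderiv ℝ (fun y => ∑ k, aCoef a b d c y j k * pd k w y) x
      (EuclideanSpace.single j 1) := by
  refine Finset.sum_congr rfl fun j _ => ?_
  rw [fderiv_fun_sum fun k _ => h j k, sum_apply]
  rfl

lemma hasDerivAt_smul_sph (φ θ t : ℝ) : HasDerivAt (fun t : ℝ => t • sph φ θ) (sph φ θ) t := by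
  simpa using (hasDerivAt_id t).smul_const (sph φ θ)

lemma hasDerivAt_radial {w : E3 → ℝ} (hw : ContDiff ℝ 2 w) (φ θ t : ℝ) :
    HasDerivAt (fun t => fderiv ℝ w (t • sph φ θ) (sph φ θ))
      (fderiv ℝ (fderiv ℝ w) (t • sph φ θ) (sph φ θ) (sph φ θ)) t := by
  have h1 : HasFDerivAt (fderiv ℝ w) (fderiv ℝ (fderiv ℝ w) (t • sph φ θ)) (t • sph φ θ) :=
    ((hw.fderiv_right (m := 1) (by norm_num)).differentiable (by norm_num) _).hasFDerivAt
  have h2 : HasDerivAt (fun t : ℝ => fderiv ℝ w (t • sph φ θ))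
      (fderiv ℝ (fderiv ℝ w) (t • sph φ θ) (sph φ θ)) t :=
    h1.comp_hasDerivAt t (hasDerivAt_smul_sph φ θ t)
  simpa using h2.clm_apply (hasDerivAt_const t (sph φ θ))

lemma continuous_sph_swap : Continuous fun p : ℝ × ℝ × ℝ => sph p.2.2 p.2.1 := by
  refine (EuclideanSpace.equiv (Fin 3) ℝ).symm.continuous.comp (continuous_pi fun i => ?_)
  fin_cases i <;> simp <;> fun_prop

lemma continuous_smul_sph_apply {f : E3 → E3 →L[ℝ] ℝ} (hf : Continuous f) :
    Continuous fun p : ℝ × ℝ × ℝ => f (p.1 • sph p.2.2 p.2.1) (sph p.2.2 p.2.1) := by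
  have hfs : Continuous fun p : ℝ × ℝ × ℝ => f (p.1 • sph p.2.2 p.2.1) :=
    hf.comp (continuous_fst.smul continuous_sph_swap)
  exact hfs.clm_apply continuous_sph_swap

lemma continuous_radial_snd {w : E3 → ℝ} (hw : ContDiff ℝ 2 w) :
    Continuous fun p : ℝ × ℝ × ℝ =>
      fderiv ℝ (fderiv ℝ w) (p.1 • sph p.2.2 p.2.1) (sph p.2.2 p.2.1) (sph p.2.2 p.2.1) := by
  have h2 : Continuous (fderiv ℝ (fderiv ℝ w)) :=
    (hw.fderiv_right (m := 1) (by norm_num)).continuous_fderiv (by norm_num)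
  have h3 : Continuous fun p : ℝ × ℝ × ℝ => fderiv ℝ (fderiv ℝ w) (p.1 • sph p.2.2 p.2.1) :=
    h2.comp (continuous_fst.smul continuous_sph_swap)
  exact (h3.clm_apply continuous_sph_swap).clm_apply continuous_sph_swap

lemma hasDerivAt_Phi {w : E3 → ℝ} (hw : ContDiff ℝ 2 w) (r : ℝ) :
    HasDerivAt (Phi w) (∫ θ in (0:ℝ)..π, Real.sin θ * ∫ φ in (0:ℝ)..(2 * π),
      fderiv ℝ w (r • sph φ θ) (sph φ θ)) r := by
  refine hasDerivAt_sphere_integral (f := fun t θ φ => w (t • sph φ θ))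
    (f' := fun t θ φ => fderiv ℝ w (t • sph φ θ) (sph φ θ))
    (hw.continuous.comp (continuous_fst.smul continuous_sph_swap))
    (continuous_smul_sph_apply (hw.continuous_fderiv (by norm_num))) (fun t θ φ => ?_) _ _ _ _ r
  exact ((hw.differentiable (by norm_num) _).hasFDerivAt).comp_hasDerivAt t
    (hasDerivAt_smul_sph φ θ t)

lemma hasDerivAt_deriv_Phi {w : E3 → ℝ} (hw : ContDiff ℝ 2 w) (r : ℝ) :
    HasDerivAt (deriv (Phi w)) (∫ θ in (0:ℝ)..π, Real.sin θ * ∫ φ in (0:ℝ)..(2 * π),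
      fderiv ℝ (fderiv ℝ w) (r • sph φ θ) (sph φ θ) (sph φ θ)) r := by
  rw [funext fun t => (hasDerivAt_Phi hw t).deriv]
  exact hasDerivAt_sphere_integral (f := fun t θ φ => fderiv ℝ w (t • sph φ θ) (sph φ θ))
    (f' := fun t θ φ => fderiv ℝ (fderiv ℝ w) (t • sph φ θ) (sph φ θ) (sph φ θ))
    (continuous_smul_sph_apply (hw.continuous_fderiv (by norm_num))) (continuous_radial_snd hw)
    (fun t θ φ => hasDerivAt_radial hw φ θ t) _ _ _ _ r

lemma sphere_integral_linear {f g : ℝ → ℝ → ℝ} (hf : Continuous f.uncurry)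
    (hg : Continuous g.uncurry) (α β a b c d : ℝ) :
    ∫ θ in a..b, Real.sin θ * ∫ φ in c..d, (α * f θ φ + β * g θ φ)
      = α * (∫ θ in a..b, Real.sin θ * ∫ φ in c..d, f θ φ)
        + β * ∫ θ in a..b, Real.sin θ * ∫ φ in c..d, g θ φ := by
  have hcont : ∀ k : ℝ → ℝ → ℝ, Continuous k.uncurry →
      Continuous fun θ => Real.sin θ * ∫ φ in c..d, k θ φ := fun k hk =>
    Real.continuous_sin.mul
      (intervalIntegral.continuous_parametric_intervalIntegral_of_continuous' hk _ _)
  rw [← intervalIntegral.integral_const_mul, ← intervalIntegral.integral_const_mul,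
    ← intervalIntegral.integral_add (((hcont f hf).const_mul α).intervalIntegrable _ _)
      (((hcont g hg).const_mul β).intervalIntegrable _ _)]
  refine intervalIntegral.integral_congr fun θ _ => ?_
  have hsec : ∀ k : ℝ → ℝ → ℝ, Continuous k.uncurry → IntervalIntegrable (k θ) volume c d :=
    fun k hk => (hk.comp (Continuous.prodMk_right θ)).intervalIntegrable _ _
  rw [intervalIntegral.integral_add ((hsec f hf).const_mul α) ((hsec g hg).const_mul β),
    intervalIntegral.integral_const_mul, intervalIntegral.integral_const_mul]
  ring

lemma Phi_Aop_of_contDiff {a b d : ℝ → ℝ} {c w : E3 → ℝ} {r : ℝ} (hr : 0 < r)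
    (ha : ContDiffAt ℝ 1 a r) (hb : ContDiffAt ℝ 1 b r) (hd : ContDiffAt ℝ 1 d r)
    (hc : ∀ x, ‖x‖ = r → ContDiffAt ℝ 1 c x) (hw : ContDiff ℝ 2 w) :
    Phi (Aop a b d c w) r
      = (a r - d r) * deriv (deriv (Phi w)) r + (deriv a r - deriv d r) * deriv (Phi w) r
        + (2 * (a r - d r) / r) * deriv (Phi w) r := by
  have hprod : ∀ j k φ θ, ContDiffAt ℝ 1 (fun y => aCoef a b d c y j k * pd k w y)
      (r • sph φ θ) := by
    intro j k φ θ
    have hn := norm_smul_sph hr.le φ θ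
    have h0 : r • sph φ θ ≠ 0 := norm_pos_iff.1 (by rwa [hn])
    refine (contDiffAt_aCoef h0 ?_ ?_ ?_ (hc _ hn) j k).mul
      (contDiff_pd hw k).contDiffAt <;> rwa [hn]
  set F : Fin 3 → E3 → ℝ := fun j y => ∑ k, aCoef a b d c y j k * pd k w y with hFdef
  have hF : ∀ j φ θ, ContDiffAt ℝ 1 (F j) (r • sph φ θ) := fun j φ θ =>
    ContDiffAt.sum fun k _ => hprod j k φ θ
  have hradial : ∀ φ θ, ∑ j, fderiv ℝ (F j) (r • sph φ θ) (sph φ θ) * sph φ θ j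
      = (deriv a r - deriv d r) * fderiv ℝ w (r • sph φ θ) (sph φ θ)
        + (a r - d r) * fderiv ℝ (fderiv ℝ w) (r • sph φ θ) (sph φ θ) (sph φ θ) := by
    intro φ θ
    have h1 : HasDerivAt (fun t : ℝ => ∑ j, F j (t • sph φ θ) * sph φ θ j)
        (∑ j, fderiv ℝ (F j) (r • sph φ θ) (sph φ θ) * sph φ θ j) r :=
      HasDerivAt.fun_sum fun j _ =>
        ((((hF j φ θ).differentiableAt (by norm_num)).hasFDerivAt).comp_hasDerivAt r
          (hasDerivAt_smul_sph φ θ r)).mul_const _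
    have h2 := ((ha.differentiableAt (by norm_num)).hasDerivAt.sub
      (hd.differentiableAt (by norm_num)).hasDerivAt).mul (hasDerivAt_radial hw φ θ r)
    refine h1.unique (h2.congr_of_eventuallyEq ?_)
    filter_upwards [lt_mem_nhds hr] with t ht
    exact sum_aCoef_mul_pd_radial a b d c w ht φ θ
  have hmain := sphere_integral_divergence hF
  have hA : ∀ φ θ, ∑ j, fderiv ℝ (F j) (r • sph φ θ) (EuclideanSpace.single j 1)
      = Aop a b d c w (r • sph φ θ) := fun φ θ =>
    (Aop_eq_sum_fderiv fun j k => (hprod j k φ θ).differentiableAt (by norm_num)).symm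
  have hint : ∀ φ θ, r * ∑ j, fderiv ℝ (F j) (r • sph φ θ) (sph φ θ) * sph φ θ j
        + 2 * ∑ j, F j (r • sph φ θ) * sph φ θ j
      = (r * (deriv a r - deriv d r) + 2 * (a r - d r)) * fderiv ℝ w (r • sph φ θ) (sph φ θ)
        + r * (a r - d r) * fderiv ℝ (fderiv ℝ w) (r • sph φ θ) (sph φ θ) (sph φ θ) := by
    intro φ θ
    rw [hradial, sum_aCoef_mul_pd_radial a b d c w hr]
    ring
  have hsec : Continuous fun p : ℝ × ℝ => (r, p.1, p.2) := by fun_prop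
  simp only [hA, hint] at hmain
  rw [sphere_integral_linear (f := fun θ φ => fderiv ℝ w (r • sph φ θ) (sph φ θ))
      (g := fun θ φ => fderiv ℝ (fderiv ℝ w) (r • sph φ θ) (sph φ θ) (sph φ θ))
      ((continuous_smul_sph_apply (hw.continuous_fderiv (by norm_num))).comp hsec)
      ((continuous_radial_snd hw).comp hsec),
    ← (hasDerivAt_Phi hw r).deriv, ← (hasDerivAt_deriv_Phi hw r).deriv] at hmain
  change r * Phi (Aop a b d c w) r = _ at hmain
  field_simp
  linear_combination hmain

lemma exists_contDiff_eqOn_ball {w : E3 → ℝ} {U : Set E3} {ρ R : ℝ} (hU : IsOpen U)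
    (hRU : Metric.closedBall 0 R ⊆ U) (hw : ContDiffOn ℝ 2 w U) (hρ : 0 < ρ) (hρR : ρ < R) :
    ∃ v : E3 → ℝ, ContDiff ℝ 2 v ∧ Set.EqOn v w (Metric.ball 0 ρ) := by
  let f : ContDiffBump (0 : E3) := ⟨ρ, R, hρ, hρR⟩
  refine ⟨fun x => f x * w x, contDiff_iff_contDiffAt.2 fun x => ?_, fun x hx => ?_⟩
  · by_cases hx : x ∈ U
    · exact f.contDiffAt.mul (hw.contDiffAt (hU.mem_nhds hx))
    · have hx' : x ∉ tsupport f := fun h => hx (hRU (by rwa [f.tsupport_eq] at h))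
      refine (contDiffAt_const (c := (0 : ℝ))).congr_of_eventuallyEq ?_
      filter_upwards [notMem_tsupport_iff_eventuallyEq.1 hx'] with y hy
      simp [hy]
  · simp [f.one_of_mem_closedBall (Metric.ball_subset_closedBall hx)]

lemma Phi_congr {v w : E3 → ℝ} {r : ℝ} (h : ∀ φ θ, v (r • sph φ θ) = w (r • sph φ θ)) :
    Phi v r = Phi w r := by
  simp only [Phi, h]

lemma Aop_congr {a b d : ℝ → ℝ} {c v w : E3 → ℝ} {s : Set E3} (hs : IsOpen s)
    (h : Set.EqOn v w s) : Set.EqOn (Aop a b d c v) (Aop a b d c w) s := by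
  intro x hx
  refine Finset.sum_congr rfl fun j _ => Finset.sum_congr rfl fun k _ => ?_
  have hpd : (fun y => aCoef a b d c y j k * pd k v y)
      =ᶠ[nhds x] fun y => aCoef a b d c y j k * pd k w y := by
    filter_upwards [hs.mem_nhds hx] with y hy
    simp only [pd, (h.eventuallyEq_of_mem (hs.mem_nhds hy)).fderiv_eq]
  simp only [pd] at hpd ⊢
  rw [hpd.fderiv_eq]

/-- `Φ ∘ A = Ã₁ ∘ Φ` where `Ã₁ = D_r(h D_r) + (2h/r) D_r` and
`h = a - d`: for every `r ∈ (0,R)`,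
`Φ[Aw](r) = h(r)(Φw)''(r) + h'(r)(Φw)'(r) + (2h(r)/r)(Φw)'(r)`. -/
theorem stmt8 (R : ℝ) (hR : 0 < R)
    (a b d : ℝ → ℝ) (c : EuclideanSpace ℝ (Fin 3) → ℝ)
    (ha : ContDiffOn ℝ 1 a (Set.Icc 0 R)) (hb : ContDiffOn ℝ 1 b (Set.Icc 0 R))
    (hd : ContDiffOn ℝ 1 d (Set.Icc 0 R))
    (hc : ContDiffOn ℝ 1 c (Metric.closedBall 0 R))
    (w : EuclideanSpace ℝ (Fin 3) → ℝ)
    (hw : ∃ U, IsOpen U ∧ Metric.closedBall (0 : EuclideanSpace ℝ (Fin 3)) R ⊆ U ∧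
        ContDiffOn ℝ 2 w U) :
    ∀ r ∈ Set.Ioo (0:ℝ) R,
      DifferentiableAt ℝ (Phi w) r ∧ DifferentiableAt ℝ (deriv (Phi w)) r ∧
      Phi (Aop a b d c w) r
        = (a r - d r) * deriv (deriv (Phi w)) r
          + (derivWithin a (Set.Icc 0 R) r - derivWithin d (Set.Icc 0 R) r)
              * deriv (Phi w) r
          + (2 * (a r - d r) / r) * deriv (Phi w) r := by
  obtain ⟨U, hU, hRU, hwU⟩ := hw
  intro r ⟨hr0, hrR⟩
  obtain ⟨ρ, hrρ, hρR⟩ := exists_between hrR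
  obtain ⟨v, hv, hvw⟩ := exists_contDiff_eqOn_ball hU hRU hwU (hr0.trans hrρ) hρR
  have hmem : ∀ t, 0 ≤ t → t < ρ → ∀ φ θ, t • sph φ θ ∈ Metric.ball (0 : E3) ρ := by
    intro t ht htρ φ θ
    rwa [mem_ball_zero_iff, norm_smul_sph ht]
  have hPhi : Phi v =ᶠ[nhds r] Phi w := by
    filter_upwards [Ioo_mem_nhds hr0 hrρ] with t ht
    exact Phi_congr fun φ θ => hvw (hmem t ht.1.le ht.2 φ θ)
  have hI : Set.Icc 0 R ∈ nhds r := Icc_mem_nhds hr0 hrR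
  refine ⟨(hasDerivAt_Phi hv r).differentiableAt.congr_of_eventuallyEq hPhi.symm,
    (hasDerivAt_deriv_Phi hv r).differentiableAt.congr_of_eventuallyEq hPhi.symm.deriv, ?_⟩
  rw [derivWithin_of_mem_nhds hI, derivWithin_of_mem_nhds hI, ← hPhi.deriv_eq,
    ← hPhi.deriv.deriv_eq, ← Phi_Aop_of_contDiff (b := b) (c := c) hr0 (ha.contDiffAt hI)
      (hb.contDiffAt hI) (hd.contDiffAt hI) (fun x hx => hc.contDiffAt ?_) hv]
  · exact (Phi_congr fun φ θ => Aop_congr Metric.isOpen_ball hvw (hmem r hr0.le hrρ φ θ)).symm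
  · exact Filter.mem_of_superset (Metric.isOpen_ball.mem_nhds (by simpa [hx] using hrR))
      Metric.ball_subset_closedBall
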